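/- Iterated trickling down. Let (X,w) be a pure d-dimensional weighted simplicial complex with d ≥ 2 and let λ ∈ (0,1]. Assume: (i) for every face τ ∈ X with |τ| ≤ d−1 the link graph of τ is connected; and (ii) for every face τ ∈ X with |τ| = d−1, λ₂(A_τ) ≤ λ/(1+(d−1)λ). Then X is a λ-local spectral expander: for every face τ ∈ X with |τ| ≤ d−1 (including the empty face), λ₂(A_τ) ≤ λ. -/

import Mathlib

open Finset

/-- The vertices of the link of a face `τ`. -/
def linkVerts {V : Type*} [Fintype V] [DecidableEq V]
    (X : Finset (Finset V)) (τ : Finset V) : Finset V :=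
  Finset.univ.filter fun v => v ∉ τ ∧ insert v τ ∈ X

/-- Adjacency in the link graph of a face `τ`. -/
def linkAdj {V : Type*} [Fintype V] [DecidableEq V]
    (X : Finset (Finset V)) (τ : Finset V) (v x : V) : Prop :=
  v ∈ linkVerts X τ ∧ x ∈ linkVerts X τ ∧ v ≠ x ∧ insert v (insert x τ) ∈ X

/-- The link graph of `τ` is connected. -/
def linkConnected {V : Type*} [Fintype V] [DecidableEq V]
    (X : Finset (Finset V)) (τ : Finset V) : Prop :=
  ∀ v ∈ linkVerts X τ, ∀ x ∈ linkVerts X τ, Relation.ReflTransGen (linkAdj X τ) v x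

/-- `λ₂(A_τ) ≤ γ` for the link random-walk matrix
`A_τ(v,x) = w(τ∪{v,x}) / ((|τ|+2)·w(τ∪{v}))`. -/
def lamTwoLe {V : Type*} [Fintype V] [DecidableEq V]
    (X : Finset (Finset V)) (w : Finset V → ℝ) (τ : Finset V) (γ : ℝ) : Prop :=
  ∀ g : V → ℝ,
    (∑ v ∈ linkVerts X τ, w (insert v τ) * g v) = 0 →
    (∑ v ∈ linkVerts X τ, ∑ x ∈ linkVerts X τ,
        if v ≠ x ∧ insert x (insert v τ) ∈ X then
          w (insert v τ) *
            (w (insert x (insert v τ)) / ((τ.card + 2 : ℝ) * w (insert v τ))) * g v * g x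
        else 0)
      ≤ γ * ∑ v ∈ linkVerts X τ, w (insert v τ) * g v ^ 2

/-- If every eigenvalue `μ` of a symmetric operator satisfies `μ ≤ 1` and `μ ≤ γ + (1 - γ) μ ^ 2`,
then away from the eigenvalue `1` the operator is bounded above by `γ / (1 - γ)`. -/
theorem inner_apply_le_of_quadratic_bound {E : Type*} [NormedAddCommGroup E]
    [InnerProductSpace ℝ E] [FiniteDimensional ℝ E] {T : E →ₗ[ℝ] E} (hT : T.IsSymmetric)
    {γ : ℝ} (hγ : γ < 1)
    (h_le : ∀ x, inner ℝ (T x) x ≤ ‖x‖ ^ 2)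
    (h_quad : ∀ x, inner ℝ (T x) x ≤ γ * ‖x‖ ^ 2 + (1 - γ) * ‖T x‖ ^ 2)
    {x : E} (hx : ∀ y, T y = y → inner ℝ y x = 0) :
    inner ℝ (T x) x ≤ γ / (1 - γ) * ‖x‖ ^ 2 := by
  set b := hT.eigenvectorBasis rfl
  set μ := hT.eigenvalues rfl
  have hTb : ∀ i, T (b i) = μ i • b i := fun i => hT.apply_eigenvectorBasis rfl i
  have hnorm : ∀ i, ‖b i‖ = 1 := fun i => b.orthonormal.1 i
  have hinner : ∀ i, inner ℝ (T (b i)) (b i) = μ i := fun i => by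
    rw [hTb, real_inner_smul_left, real_inner_self_eq_norm_sq, hnorm]; ring
  have h1 : inner ℝ (T x) x = ∑ i, μ i * inner ℝ (b i) x ^ 2 := by
    rw [← b.sum_inner_mul_inner]
    refine Finset.sum_congr rfl fun i _ => ?_
    rw [hT x (b i), hTb, real_inner_smul_right, real_inner_comm]; ring
  have h2 : ‖x‖ ^ 2 = ∑ i, inner ℝ (b i) x ^ 2 := by
    rw [← real_inner_self_eq_norm_sq, ← b.sum_inner_mul_inner]
    refine Finset.sum_congr rfl fun i _ => ?_
    rw [real_inner_comm]; ring
  rw [h1, h2, Finset.mul_sum]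
  refine Finset.sum_le_sum fun i _ => ?_
  by_cases hi : μ i = 1
  · rw [hx (b i) (by rw [hTb, hi, one_smul])]; simp
  · refine mul_le_mul_of_nonneg_right ?_ (sq_nonneg _)
    have hle := h_le (b i)
    have hquad := h_quad (b i)
    rw [hinner, hnorm] at hle hquad
    rw [hTb, norm_smul, hnorm, mul_one, Real.norm_eq_abs, sq_abs] at hquad
    have hlt : μ i < 1 := lt_of_le_of_ne (by linarith) hi
    rw [le_div_iff₀ (by linarith)]
    by_contra! hcon
    nlinarith [mul_pos (sub_pos.2 hlt) (sub_pos.2 hcon)]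

section WeightedGraph

variable {V : Type*} [Fintype V] {m : V → ℝ} {e : V → V → ℝ}

theorem sum_mul_sub_sq (hsymm : ∀ v x, e v x = e x v) (hsum : ∀ v, ∑ x, e v x = m v)
    (f : V → ℝ) :
    ∑ v, ∑ x, e v x * (f v - f x) ^ 2 =
      2 * (∑ v, m v * f v ^ 2 - ∑ v, ∑ x, e v x * f v * f x) := by
  have h1 : ∑ v, ∑ x, e v x * f v ^ 2 = ∑ v, m v * f v ^ 2 := by
    simp_rw [← Finset.sum_mul, hsum]
  have h2 : ∑ v, ∑ x, e v x * f x ^ 2 = ∑ v, m v * f v ^ 2 := by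
    rw [Finset.sum_comm, ← h1]
    simp_rw [fun v x => hsymm x v]
  calc ∑ v, ∑ x, e v x * (f v - f x) ^ 2
      = ∑ v, ∑ x, e v x * f v ^ 2 + ∑ v, ∑ x, e v x * f x ^ 2
          - 2 * ∑ v, ∑ x, e v x * f v * f x := by
        simp_rw [Finset.mul_sum, ← Finset.sum_add_distrib, ← Finset.sum_sub_distrib]
        exact Finset.sum_congr rfl fun v _ => Finset.sum_congr rfl fun x _ => by ring
    _ = _ := by rw [h1, h2]; ring

/-- On a connected weighted graph, a function with no Dirichlet energy is constant on the vertices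
of positive mass. -/
theorem eq_of_sum_mul_sub_sq_nonpos (he : ∀ v x, 0 ≤ e v x)
    (hconn : ∀ v x, 0 < m v → 0 < m x → Relation.ReflTransGen (fun a b => 0 < e a b) v x)
    {f : V → ℝ} (hf : ∑ v, ∑ x, e v x * (f v - f x) ^ 2 ≤ 0) {v x : V}
    (hv : 0 < m v) (hx : 0 < m x) : f v = f x := by
  have hnonneg : ∀ a b, 0 ≤ e a b * (f a - f b) ^ 2 := fun a b =>
    mul_nonneg (he a b) (sq_nonneg _)
  have hedge : ∀ a b, 0 < e a b → f a = f b := by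
    intro a b hab
    have h0 := le_antisymm hf (Finset.sum_nonneg fun a _ => Finset.sum_nonneg fun b _ => hnonneg a b)
    rw [Finset.sum_eq_zero_iff_of_nonneg
      fun a _ => Finset.sum_nonneg fun b _ => hnonneg a b] at h0
    have h1 := h0 a (Finset.mem_univ a)
    rw [Finset.sum_eq_zero_iff_of_nonneg fun b _ => hnonneg a b] at h1
    have h2 := (mul_eq_zero.1 (h1 b (Finset.mem_univ b))).resolve_left hab.ne'
    exact sub_eq_zero.1 (pow_eq_zero_iff two_ne_zero |>.1 h2)
  have key := hconn v x hv hx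
  clear hv
  induction key using Relation.ReflTransGen.head_induction_on with
  | refl => rfl
  | head h _ ih => exact (hedge _ _ h).trans ih

open Classical in
/-- A quadratic bound on the random walk of a connected weighted graph bounds its second
eigenvalue. -/
theorem quadraticForm_le_of_quadratic_bound (hm : ∀ v, 0 ≤ m v) (he : ∀ v x, 0 ≤ e v x)
    (hsymm : ∀ v x, e v x = e x v) (hsum : ∀ v, ∑ x, e v x = m v)
    (hconn : ∀ v x, 0 < m v → 0 < m x → Relation.ReflTransGen (fun a b => 0 < e a b) v x)
    {γ : ℝ} (hγ0 : 0 ≤ γ) (hγ1 : γ < 1)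
    (hquad : ∀ f : V → ℝ, ∑ v, ∑ x, e v x * f v * f x ≤
      γ * ∑ v, m v * f v ^ 2 + (1 - γ) * ∑ v, (∑ x, e v x * f x) ^ 2 / m v)
    {g : V → ℝ} (hg : ∑ v, m v * g v = 0) :
    ∑ v, ∑ x, e v x * g v * g x ≤ γ / (1 - γ) * ∑ v, m v * g v ^ 2 := by
  set M : Matrix V V ℝ := fun v x => e v x / (√(m v) * √(m x)) with hM
  have hMsymm : M.IsHermitian := by
    ext v x
    rw [Matrix.conjTranspose_apply, star_trivial, hM]
    change e x v / (√(m x) * √(m v)) = e v x / (√(m v) * √(m x))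
    rw [hsymm x v, mul_comm]
  set T := Matrix.toEuclideanLin M
  have hT : T.IsSymmetric := Matrix.isSymmetric_toEuclideanLin_iff.2 hMsymm
  have hT_apply : ∀ (h : EuclideanSpace ℝ V) v,
      T h v = (∑ x, e v x * (h x / √(m x))) / √(m v) := by
    intro h v
    change ∑ x, e v x / (√(m v) * √(m x)) * h x = _
    rw [Finset.sum_div]
    exact Finset.sum_congr rfl fun x _ => by
      simp only [div_eq_mul_inv, mul_inv]; ring
  have h_inner : ∀ h : EuclideanSpace ℝ V, inner ℝ (T h) h =
      ∑ v, ∑ x, e v x * (h v / √(m v)) * (h x / √(m x)) := by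
    intro h
    rw [PiLp.inner_apply]
    refine Finset.sum_congr rfl fun v _ => ?_
    rw [hT_apply, real_inner_comm, RCLike.inner_apply, conj_trivial, Finset.sum_div, Finset.sum_mul]
    exact Finset.sum_congr rfl fun x _ => by simp only [div_eq_mul_inv]; ring
  have h_norm : ∀ h : EuclideanSpace ℝ V, ∑ v, m v * (h v / √(m v)) ^ 2 ≤ ‖h‖ ^ 2 := by
    intro h
    rw [EuclideanSpace.real_norm_sq_eq]
    refine Finset.sum_le_sum fun v _ => ?_
    rcases (hm v).eq_or_lt with h0 | h0
    · rw [← h0]; simp [sq_nonneg]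
    · rw [div_pow, Real.sq_sqrt h0.le, mul_div_cancel₀ _ h0.ne']
  have h_normT : ∀ h : EuclideanSpace ℝ V,
      ‖T h‖ ^ 2 = ∑ v, (∑ x, e v x * (h x / √(m x))) ^ 2 / m v := by
    intro h
    rw [EuclideanSpace.real_norm_sq_eq]
    exact Finset.sum_congr rfl fun v _ => by
      rw [hT_apply, div_pow, Real.sq_sqrt (hm v)]
  have h_energy := sum_mul_sub_sq hsymm hsum
  have h_energy_nonneg : ∀ f : V → ℝ, 0 ≤ ∑ v, ∑ x, e v x * (f v - f x) ^ 2 := fun f =>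
    Finset.sum_nonneg fun v _ => Finset.sum_nonneg fun x _ =>
      mul_nonneg (he v x) (sq_nonneg _)
  have e_zero : ∀ v x, m v = 0 → e v x = 0 := fun v x h0 =>
    (Finset.sum_eq_zero_iff_of_nonneg fun y _ => he v y).1 ((hsum v).trans h0) x
      (Finset.mem_univ x)
  have key := inner_apply_le_of_quadratic_bound hT hγ1
    (fun h => by
      have h1 := h_energy (fun v => h v / √(m v))
      have h2 := h_energy_nonneg (fun v => h v / √(m v))
      have h3 := h_norm h
      rw [h_inner]
      linarith)
    (fun h => by
      rw [h_inner, h_normT]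
      have h1 := hquad (fun v => h v / √(m v))
      have h2 := mul_le_mul_of_nonneg_left (h_norm h) hγ0
      linarith)
    (x := WithLp.toLp 2 fun v => √(m v) * g v)
    (fun h hh => by
      have h1 := h_energy (fun v => h v / √(m v))
      have h2 := h_norm h
      have h3 := h_inner h
      rw [hh, real_inner_self_eq_norm_sq] at h3
      have hconst := fun v x => eq_of_sum_mul_sub_sq_nonpos (v := v) (x := x) he hconn
        (h1.le.trans (by linarith))
      have h4 : inner ℝ h (WithLp.toLp 2 fun v => √(m v) * g v) =
          ∑ v, (h v / √(m v)) * (m v * g v) := by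
        rw [PiLp.inner_apply]
        refine Finset.sum_congr rfl fun v _ => ?_
        rw [real_inner_comm, RCLike.inner_apply, conj_trivial]
        rcases (hm v).eq_or_lt with h0 | h0
        · simp [← h0]
        · have := Real.sqrt_pos.2 h0
          field_simp
          rw [Real.sq_sqrt h0.le]
          ring
      rw [h4]
      by_cases hex : ∃ u, 0 < m u
      · obtain ⟨u, hu⟩ := hex
        calc ∑ v, (h v / √(m v)) * (m v * g v) = ∑ v, (h u / √(m u)) * (m v * g v) := by
              refine Finset.sum_congr rfl fun v _ => ?_
              rcases (hm v).eq_or_lt with h0 | h0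
              · rw [← h0]; simp
              · rw [hconst v u h0 hu]
          _ = 0 := by rw [← Finset.mul_sum, hg, mul_zero]
      · push Not at hex
        exact Finset.sum_eq_zero fun v _ => by rw [le_antisymm (hex v) (hm v)]; simp)
  have hval : ∀ v x, e v x * (√(m v) * g v / √(m v)) * (√(m x) * g x / √(m x)) =
      e v x * g v * g x := by
    intro v x
    rcases (hm v).eq_or_lt with h0 | h0
    · simp [e_zero v x h0.symm]
    rcases (hm x).eq_or_lt with h1 | h1
    · simp [hsymm v x, e_zero x v h1.symm]
    rw [mul_div_cancel_left₀ _ (Real.sqrt_pos.2 h0).ne',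
      mul_div_cancel_left₀ _ (Real.sqrt_pos.2 h1).ne']
  rw [h_inner, EuclideanSpace.real_norm_sq_eq] at key
  simp only [hval, mul_pow, Real.sq_sqrt (hm _)] at key
  exact key

/-- Oppenheim's trickling-down theorem for symmetric weights on edges and triangles: a bound `γ` on
the second eigenvalue of every vertex link yields the bound `γ / (1 - γ)` globally. -/
theorem trickling_down {t : V → V → V → ℝ} (hm : ∀ v, 0 ≤ m v) (he : ∀ v x, 0 ≤ e v x)
    (hsymm : ∀ v x, e v x = e x v) (hsum : ∀ v, ∑ x, e v x = m v)
    (ht_right : ∀ v x, ∑ y, t v x y = e v x) (ht_mid : ∀ v y, ∑ x, t v x y = e v y)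
    (ht_left : ∀ x y, ∑ v, t v x y = e x y)
    (hconn : ∀ v x, 0 < m v → 0 < m x → Relation.ReflTransGen (fun a b => 0 < e a b) v x)
    {γ : ℝ} (hγ0 : 0 ≤ γ) (hγ1 : γ < 1)
    (hlink : ∀ v, ∀ g : V → ℝ, ∑ x, e v x * g x = 0 →
      ∑ x, ∑ y, t v x y * g x * g y ≤ γ * ∑ x, e v x * g x ^ 2)
    {g : V → ℝ} (hg : ∑ v, m v * g v = 0) :
    ∑ v, ∑ x, e v x * g v * g x ≤ γ / (1 - γ) * ∑ v, m v * g v ^ 2 := by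
  refine quadraticForm_le_of_quadratic_bound hm he hsymm hsum hconn hγ0 hγ1 (fun f => ?_) hg
  set a : V → ℝ := fun v => ∑ x, e v x * f x with ha
  have e_zero : ∀ v x, m v = 0 → e v x = 0 := fun v x h0 =>
    (Finset.sum_eq_zero_iff_of_nonneg fun y _ => he v y).1 ((hsum v).trans h0) x
      (Finset.mem_univ x)
  have hcm : ∀ v, a v / m v * m v = a v := fun v => by
    by_cases h0 : m v = 0
    · simp [ha, e_zero v _ h0]
    · exact div_mul_cancel₀ _ h0
  have hloc : ∀ v, ∑ x, ∑ y, t v x y * f x * f y ≤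
      γ * ∑ x, e v x * f x ^ 2 + (1 - γ) * (a v ^ 2 / m v) := by
    intro v
    set c := a v / m v with hc
    have hac : a v ^ 2 / m v = c * a v := by rw [hc]; ring
    have hcm' : c * m v = a v := hcm v
    have hmean : ∑ x, e v x * (f x - c) = 0 := by
      simp_rw [mul_sub, Finset.sum_sub_distrib, ← Finset.sum_mul, hsum]
      linarith
    have hsq : ∑ x, e v x * (f x - c) ^ 2 = ∑ x, e v x * f x ^ 2 - c * a v := by
      calc ∑ x, e v x * (f x - c) ^ 2
          = ∑ x, e v x * f x ^ 2 - 2 * c * ∑ x, e v x * f x + c ^ 2 * ∑ x, e v x := by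
            simp_rw [Finset.mul_sum, ← Finset.sum_sub_distrib, ← Finset.sum_add_distrib]
            exact Finset.sum_congr rfl fun x _ => by ring
        _ = _ := by
            rw [hsum]
            change _ - 2 * c * a v + _ = _
            linear_combination c * hcm'
    have hform : ∑ x, ∑ y, t v x y * (f x - c) * (f y - c) =
        ∑ x, ∑ y, t v x y * f x * f y - c * a v := by
      have h1 : ∑ x, ∑ y, t v x y * f x = a v := by
        simp_rw [← Finset.sum_mul, ht_right, ha]
      have h2 : ∑ x, ∑ y, t v x y * f y = a v := by
        rw [Finset.sum_comm]
        simp_rw [← Finset.sum_mul, ht_mid, ha]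
      have h3 : ∑ x, ∑ y, t v x y = m v := by simp_rw [ht_right, hsum]
      calc ∑ x, ∑ y, t v x y * (f x - c) * (f y - c)
          = ∑ x, ∑ y, t v x y * f x * f y - c * ∑ x, ∑ y, t v x y * f x
            - c * ∑ x, ∑ y, t v x y * f y + c ^ 2 * ∑ x, ∑ y, t v x y := by
            simp_rw [Finset.mul_sum, ← Finset.sum_sub_distrib, ← Finset.sum_add_distrib]
            exact Finset.sum_congr rfl fun x _ => Finset.sum_congr rfl fun y _ => by ring
        _ = _ := by
            rw [h1, h2, h3]
            linear_combination c * hcm'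
    have := hlink v (fun x => f x - c) hmean
    rw [hsq, hform] at this
    rw [hac]
    linarith
  have hleft : ∑ v, ∑ x, ∑ y, t v x y * f x * f y = ∑ v, ∑ x, e v x * f v * f x := by
    rw [Finset.sum_comm]
    refine Finset.sum_congr rfl fun x _ => ?_
    rw [Finset.sum_comm]
    refine Finset.sum_congr rfl fun y _ => ?_
    rw [← Finset.sum_mul, ← Finset.sum_mul, ht_left]
  have hright : ∑ v, ∑ x, e v x * f x ^ 2 = ∑ v, m v * f v ^ 2 := by
    rw [Finset.sum_comm]
    simp_rw [fun v x => hsymm x v, ← Finset.sum_mul, hsum]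
  calc ∑ v, ∑ x, e v x * f v * f x = ∑ v, ∑ x, ∑ y, t v x y * f x * f y := hleft.symm
    _ ≤ ∑ v, (γ * ∑ x, e v x * f x ^ 2 + (1 - γ) * (a v ^ 2 / m v)) :=
        Finset.sum_le_sum fun v _ => hloc v
    _ = _ := by rw [Finset.sum_add_distrib, ← Finset.mul_sum, ← Finset.mul_sum, hright]

end WeightedGraph

section LinkWeights

variable {V : Type*} [Fintype V] [DecidableEq V] {X : Finset (Finset V)} {w : Finset V → ℝ}
  {τ : Finset V}

/-- The weight of `τ ∪ {v}`, extended by zero outside the link of `τ`. -/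
def linkWeight (X : Finset (Finset V)) (w : Finset V → ℝ) (τ : Finset V) (v : V) : ℝ :=
  if v ∈ linkVerts X τ then w (insert v τ) else 0

/-- The weight of `τ ∪ {v, x}`, extended by zero outside the link graph of `τ`. -/
def linkEdgeWeight (X : Finset (Finset V)) (w : Finset V → ℝ) (τ : Finset V) (v x : V) : ℝ :=
  if v ∈ linkVerts X τ then linkWeight X w (insert v τ) x else 0

/-- The weight of `τ ∪ {v, x, y}`, extended by zero outside the triangles of the link of `τ`. -/
def linkTriangleWeight (X : Finset (Finset V)) (w : Finset V → ℝ) (τ : Finset V) (v x y : V) : ℝ :=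
  if v ∈ linkVerts X τ then linkEdgeWeight X w (insert v τ) x y else 0

theorem mem_linkVerts {v : V} : v ∈ linkVerts X τ ↔ v ∉ τ ∧ insert v τ ∈ X := by
  simp [linkVerts]

theorem card_insert_of_mem_linkVerts {v : V} (hv : v ∈ linkVerts X τ) :
    (insert v τ).card = τ.card + 1 :=
  Finset.card_insert_of_notMem (mem_linkVerts.1 hv).1

theorem mem_linkVerts_insert_swap (hdown : ∀ σ ∈ X, ∀ τ ⊆ σ, τ ∈ X) {v x : V}
    (h : v ∈ linkVerts X τ ∧ x ∈ linkVerts X (insert v τ)) :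
    x ∈ linkVerts X τ ∧ v ∈ linkVerts X (insert x τ) := by
  simp only [mem_linkVerts, Finset.mem_insert, not_or] at h ⊢
  obtain ⟨⟨hv, -⟩, ⟨hxv, hx⟩, hX⟩ := h
  rw [Finset.insert_comm] at hX
  exact ⟨⟨hx, hdown _ hX _ (Finset.subset_insert _ _)⟩, ⟨fun h => hxv h.symm, hv⟩, hX⟩

theorem linkWeight_nonneg (hw : ∀ σ ∈ X, 0 < w σ) (v : V) : 0 ≤ linkWeight X w τ v := by
  unfold linkWeight
  split_ifs with h
  · exact (hw _ (mem_linkVerts.1 h).2).le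
  · exact le_rfl

theorem linkEdgeWeight_nonneg (hw : ∀ σ ∈ X, 0 < w σ) (v x : V) :
    0 ≤ linkEdgeWeight X w τ v x := by
  unfold linkEdgeWeight
  split_ifs
  · exact linkWeight_nonneg hw x
  · exact le_rfl

theorem linkEdgeWeight_comm (hdown : ∀ σ ∈ X, ∀ τ ⊆ σ, τ ∈ X) (v x : V) :
    linkEdgeWeight X w τ v x = linkEdgeWeight X w τ x v := by
  simp only [linkEdgeWeight, linkWeight, ← ite_and]
  rw [Finset.insert_comm x v]
  exact if_congr ⟨mem_linkVerts_insert_swap hdown, mem_linkVerts_insert_swap hdown⟩ rfl rfl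

theorem linkTriangleWeight_comm (hdown : ∀ σ ∈ X, ∀ τ ⊆ σ, τ ∈ X) (v x y : V) :
    linkTriangleWeight X w τ v x y = linkTriangleWeight X w τ x v y := by
  simp only [linkTriangleWeight, linkEdgeWeight, ← ite_and]
  rw [Finset.insert_comm x v]
  exact if_congr ⟨mem_linkVerts_insert_swap hdown, mem_linkVerts_insert_swap hdown⟩ rfl rfl

theorem linkTriangleWeight_comm_right (hdown : ∀ σ ∈ X, ∀ τ ⊆ σ, τ ∈ X) (v x y : V) :
    linkTriangleWeight X w τ v x y = linkTriangleWeight X w τ v y x := by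
  simp only [linkTriangleWeight, linkEdgeWeight_comm hdown x y]

theorem linkEdgeWeight_pos_of_linkAdj (hw : ∀ σ ∈ X, 0 < w σ) {v x : V}
    (h : linkAdj X τ v x) : 0 < linkEdgeWeight X w τ v x := by
  obtain ⟨hv, hx, hvx, hX⟩ := h
  rw [Finset.insert_comm] at hX
  have hx' : x ∈ linkVerts X (insert v τ) :=
    mem_linkVerts.2 ⟨by simp [hvx.symm, (mem_linkVerts.1 hx).1], hX⟩
  rw [linkEdgeWeight, if_pos hv, linkWeight, if_pos hx']
  exact hw _ hX

theorem mem_linkVerts_of_linkWeight_pos {v : V} (h : 0 < linkWeight X w τ v) :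
    v ∈ linkVerts X τ := by
  by_contra hv
  simp [linkWeight, hv] at h

theorem sum_linkWeight_mul (f : V → ℝ) :
    ∑ v, linkWeight X w τ v * f v = ∑ v ∈ linkVerts X τ, w (insert v τ) * f v := by
  simp [linkWeight, ite_mul, Finset.sum_ite_mem]

theorem sum_cofaces_eq_sum_linkVerts :
    ∑ σ ∈ X.filter (fun σ => σ.card = τ.card + 1 ∧ τ ⊆ σ), w σ =
      ∑ v ∈ linkVerts X τ, w (insert v τ) := by
  symm
  refine Finset.sum_bij (fun v _ => insert v τ) (fun v hv => ?_) (fun v hv x hx h => ?_)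
    (fun σ hσ => ?_) (fun _ _ => rfl)
  · exact Finset.mem_filter.2 ⟨(mem_linkVerts.1 hv).2, card_insert_of_mem_linkVerts hv,
      Finset.subset_insert _ _⟩
  · exact (Finset.insert_inj (mem_linkVerts.1 hv).1).1 h
  · obtain ⟨hX, hcard, hsub⟩ := Finset.mem_filter.1 hσ
    obtain ⟨v, hv, rfl⟩ := Finset.exists_eq_insert_iff.2 ⟨hsub, hcard.symm⟩
    exact ⟨v, mem_linkVerts.2 ⟨hv, hX⟩, rfl⟩

/-- `lamTwoLe` in terms of sums over all vertices. -/
theorem lamTwoLe_iff (hdown : ∀ σ ∈ X, ∀ τ ⊆ σ, τ ∈ X) (hw : ∀ σ ∈ X, 0 < w σ) {γ : ℝ} :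
    lamTwoLe X w τ γ ↔ ∀ g : V → ℝ, ∑ v, linkWeight X w τ v * g v = 0 →
      ∑ v, ∑ x, linkEdgeWeight X w τ v x / (τ.card + 2) * g v * g x ≤
        γ * ∑ v, linkWeight X w τ v * g v ^ 2 := by
  have hform : ∀ g : V → ℝ,
      (∑ v ∈ linkVerts X τ, ∑ x ∈ linkVerts X τ,
        if v ≠ x ∧ insert x (insert v τ) ∈ X then
          w (insert v τ) *
            (w (insert x (insert v τ)) / ((τ.card + 2 : ℝ) * w (insert v τ))) * g v * g x
        else 0) =
      ∑ v, ∑ x, linkEdgeWeight X w τ v x / (τ.card + 2) * g v * g x := by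
    intro g
    rw [← Finset.sum_subset (Finset.subset_univ (linkVerts X τ))
      fun v _ hv => by simp [linkEdgeWeight, hv]]
    refine Finset.sum_congr rfl fun v hv => ?_
    rw [← Finset.sum_subset (Finset.subset_univ (linkVerts X τ))
      fun x _ hx => by rw [linkEdgeWeight_comm hdown]; simp [linkEdgeWeight, hx]]
    refine Finset.sum_congr rfl fun x hx => ?_
    have hiff : x ∈ linkVerts X (insert v τ) ↔ v ≠ x ∧ insert x (insert v τ) ∈ X := by
      simp [mem_linkVerts, (mem_linkVerts.1 hx).1, eq_comm]
    rw [linkEdgeWeight, if_pos hv, linkWeight]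
    simp only [hiff]
    split_ifs
    · have := hw _ (mem_linkVerts.1 hv).2
      field_simp
    · simp
  simp only [lamTwoLe, hform, sum_linkWeight_mul]

/-- The weight recursion at every vertex of the link. -/
theorem sum_linkEdgeWeight
    (hsum : ∀ v ∈ linkVerts X τ, ∑ x, linkWeight X w (insert v τ) x = (τ.card + 2) * w (insert v τ))
    (v : V) : ∑ x, linkEdgeWeight X w τ v x = (τ.card + 2) * linkWeight X w τ v := by
  by_cases hv : v ∈ linkVerts X τ
  · simp [linkEdgeWeight, linkWeight, hv, ← hsum v hv]
  · simp [linkEdgeWeight, linkWeight, hv]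

/-- One step of trickling down, from the links of `τ ∪ {v}` to the link of `τ`. -/
theorem lamTwoLe_of_links {d : ℕ} (hdown : ∀ σ ∈ X, ∀ τ ⊆ σ, τ ∈ X) (hw : ∀ σ ∈ X, 0 < w σ)
    (hsum : ∀ τ ∈ X, τ.card ≤ d → ∑ v, linkWeight X w τ v = (τ.card + 1) * w τ)
    (hτd : τ.card + 2 ≤ d) (hconn : linkConnected X τ) {γ : ℝ} (hγ0 : 0 ≤ γ) (hγ1 : γ < 1)
    (hlink : ∀ v ∈ linkVerts X τ, lamTwoLe X w (insert v τ) γ) :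
    lamTwoLe X w τ (γ / (1 - γ)) := by
  have hstep : ∀ ρ : Finset V, ρ.card + 1 ≤ d → ∀ v,
      ∑ x, linkEdgeWeight X w ρ v x = (ρ.card + 2) * linkWeight X w ρ v := by
    refine fun ρ hρ => sum_linkEdgeWeight fun v hv => ?_
    have hcard := card_insert_of_mem_linkVerts hv
    rw [hsum _ (mem_linkVerts.1 hv).2 (by omega), hcard]
    push_cast
    ring
  have hk2 : (0 : ℝ) < τ.card + 2 := by positivity
  have hk3 : (0 : ℝ) < τ.card + 3 := by positivity
  have ht_right : ∀ v x, ∑ y, linkTriangleWeight X w τ v x y / ((τ.card + 2) * (τ.card + 3)) =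
      linkEdgeWeight X w τ v x / (τ.card + 2) := by
    intro v x
    by_cases hv : v ∈ linkVerts X τ
    · have hcard := card_insert_of_mem_linkVerts hv
      simp only [linkTriangleWeight, linkEdgeWeight, if_pos hv]
      rw [← Finset.sum_div]
      change (∑ y, linkEdgeWeight X w (insert v τ) x y) / _ = _
      rw [hstep _ (by omega), hcard]
      push_cast
      field_simp
      ring
    · simp [linkTriangleWeight, linkEdgeWeight, hv]
  have ht_mid : ∀ v y, ∑ x, linkTriangleWeight X w τ v x y / ((τ.card + 2) * (τ.card + 3)) =
      linkEdgeWeight X w τ v y / (τ.card + 2) := fun v y => by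
    simp_rw [fun x => linkTriangleWeight_comm_right (w := w) (τ := τ) hdown v x y, ht_right]
  refine (lamTwoLe_iff hdown hw).2 fun g hg => trickling_down
    (t := fun v x y => linkTriangleWeight X w τ v x y / ((τ.card + 2) * (τ.card + 3)))
    (linkWeight_nonneg hw) (fun v x => div_nonneg (linkEdgeWeight_nonneg hw v x) hk2.le)
    (fun v x => by rw [linkEdgeWeight_comm hdown])
    (fun v => by
      rw [← Finset.sum_div, hstep τ (by omega), mul_div_cancel_left₀ _ hk2.ne'])
    ht_right ht_mid
    (fun x y => by
      simp_rw [fun v => linkTriangleWeight_comm (w := w) (τ := τ) hdown v x y, ht_mid])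
    (fun v x hv hx => ?_) hγ0 hγ1 (fun v f hf => ?_) hg
  · exact Relation.ReflTransGen.mono
      (fun a b hab => div_pos (linkEdgeWeight_pos_of_linkAdj hw hab) hk2) v x
      (hconn v (mem_linkVerts_of_linkWeight_pos hv) x (mem_linkVerts_of_linkWeight_pos hx))
  · by_cases hv : v ∈ linkVerts X τ
    · have hcard := card_insert_of_mem_linkVerts hv
      simp only [linkEdgeWeight, linkTriangleWeight, if_pos hv, div_mul_eq_mul_div,
        ← Finset.sum_div] at hf ⊢
      have h0 := (div_eq_zero_iff.1 hf).resolve_right hk2.ne'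
      have h1 := (lamTwoLe_iff hdown hw).1 (hlink v hv) f h0
      have hc : ((insert v τ).card : ℝ) + 2 = τ.card + 3 := by rw [hcard]; push_cast; ring
      simp only [hc, div_mul_eq_mul_div, ← Finset.sum_div] at h1
      rw [mul_comm ((τ.card : ℝ) + 2), ← div_div, ← mul_div_assoc]
      exact div_le_div_of_nonneg_right h1 hk2.le
    · simp [linkEdgeWeight, linkTriangleWeight, hv]

end LinkWeights

/-- **Iterated trickling down.** Let `(X,w)` be a pure `d`-dimensional
weighted simplicial complex, `d ≥ 2`, `λ ∈ (0,1]`.  If all link graphs of faces `τ` with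
`|τ| ≤ d-1` are connected and all links of faces of cardinality `d-1` satisfy
`λ₂(A_τ) ≤ λ/(1+(d-1)λ)`, then `X` is a `λ`-local spectral expander: `λ₂(A_τ) ≤ λ` for
every face `τ` with `|τ| ≤ d-1`, including the empty face. -/
theorem iterated_trickling_down {V : Type*} [Fintype V] [DecidableEq V]
    (d : ℕ) (hd : 2 ≤ d)
    (X : Finset (Finset V))
    (hdown : ∀ σ ∈ X, ∀ τ ⊆ σ, τ ∈ X)
    (hpure : ∀ σ ∈ X, (∀ ρ ∈ X, σ ⊆ ρ → σ = ρ) → σ.card = d + 1)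
    (w : Finset V → ℝ)
    (hw_pos : ∀ σ ∈ X, 0 < w σ)
    (hw_top : ∑ σ ∈ X.filter (fun σ => σ.card = d + 1), w σ = 1)
    (hw_rec : ∀ τ ∈ X, τ.card ≤ d →
      w τ = (1 / (τ.card + 1 : ℝ)) *
        ∑ σ ∈ X.filter (fun σ => σ.card = τ.card + 1 ∧ τ ⊆ σ), w σ)
    (lam : ℝ) (hlam0 : 0 < lam) (hlam1 : lam ≤ 1)
    (hconn : ∀ τ ∈ X, τ.card + 1 ≤ d → linkConnected X τ)
    (htop : ∀ τ ∈ X, τ.card + 1 = d →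
      lamTwoLe X w τ (lam / (1 + ((d : ℝ) - 1) * lam))) :
    ∀ τ ∈ X, τ.card + 1 ≤ d → lamTwoLe X w τ lam := by
  have hsum : ∀ τ ∈ X, τ.card ≤ d → ∑ v, linkWeight X w τ v = (τ.card + 1) * w τ := by
    intro τ hτ hcard
    have h := sum_linkWeight_mul (X := X) (w := w) (τ := τ) fun _ => 1
    simp only [mul_one] at h
    rw [h, hw_rec τ hτ hcard, sum_cofaces_eq_sum_linkVerts]
    field_simp
  have key : ∀ j : ℕ, ∀ τ ∈ X, τ.card + 1 + j = d →
      lamTwoLe X w τ (lam / (1 + τ.card * lam)) := by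
    intro j
    induction j with
    | zero =>
      intro τ hτ hcard
      have h := htop τ hτ hcard
      rwa [← hcard, add_zero, Nat.cast_add, Nat.cast_one, add_sub_cancel_right] at h
    | succ j ih =>
      intro τ hτ hcard
      have hpos : 0 < 1 + (τ.card : ℝ) * lam := by positivity
      have hpos' : 0 < 1 + ((τ.card : ℝ) + 1) * lam := by positivity
      have hγ1 : lam / (1 + ((τ.card : ℝ) + 1) * lam) < 1 := by
        rw [div_lt_one hpos']
        linarith
      have hγ : lam / (1 + (τ.card : ℝ) * lam) =
          lam / (1 + ((τ.card : ℝ) + 1) * lam) / (1 - lam / (1 + ((τ.card : ℝ) + 1) * lam)) := by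
        rw [one_sub_div hpos'.ne', div_div_div_cancel_right₀ hpos'.ne']
        congr 1
        ring
      rw [hγ]
      refine lamTwoLe_of_links hdown hw_pos hsum (by omega) (hconn τ hτ (by omega))
        (div_pos hlam0 hpos').le hγ1 fun v hv => ?_
      have hc := card_insert_of_mem_linkVerts hv
      have h := ih (insert v τ) (mem_linkVerts.1 hv).2 (by omega)
      rwa [hc, Nat.cast_add, Nat.cast_one] at h
  intro τ hτ hcard g hg
  refine (key (d - (τ.card + 1)) τ hτ (by omega) g hg).trans
    (mul_le_mul_of_nonneg_right ?_ (Finset.sum_nonneg fun v hv =>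
      mul_nonneg (hw_pos _ (mem_linkVerts.1 hv).2).le (sq_nonneg _)))
  exact div_le_self hlam0.le (le_add_of_nonneg_right (by positivity))
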